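/- Let R be a Noetherian integral domain and 𝔞 an ideal of R with ht(𝔞) = n. Then Ann_R(H^n_𝔞(R)) = 0. -/

import Mathlib

open CategoryTheory

universe u

/-- `H^i_I(M) ≠ 0`: the `i`-th local cohomology of `M` with respect to `I` is nonzero. -/
abbrev LCNonzero {R : Type u} [CommRing R] (I : Ideal R) (i : ℕ)
    (M : Type u) [AddCommGroup M] [Module R M] : Prop :=
  Nontrivial ((localCohomology I i).obj (ModuleCat.of R M))

/-- Cohomological dimension `cd(I, M) = sup {i : H^i_I(M) ≠ 0}`, as an element of
`WithBot ℕ∞` (it is `⊥` if all local cohomology of `M` vanishes). -/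
noncomputable def cohDim {R : Type u} [CommRing R] (I : Ideal R)
    (M : Type u) [AddCommGroup M] [Module R M] : WithBot ℕ∞ :=
  sSup {n : WithBot ℕ∞ | ∃ i : ℕ, n = (i : ℕ∞) ∧ LCNonzero I i M}

/-- Krull dimension of a module, i.e. the Krull dimension of `R ⧸ Ann_R M`. -/
noncomputable def modDim (R : Type u) [CommRing R]
    (M : Type u) [AddCommGroup M] [Module R M] : WithBot ℕ∞ :=
  ringKrullDim (R ⧸ Module.annihilator R M)

/-- The height of an ideal: the infimum of `Order.height p` over primes `p` minimal
over `I`. -/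
noncomputable def idealHeight {R : Type u} [CommRing R] (I : Ideal R) : ℕ∞ :=
  ⨅ p ∈ {p : PrimeSpectrum R | Minimal (fun q : PrimeSpectrum R => I ≤ q.asIdeal) p},
    Order.height p

section aux
open PrimeSpectrum

section alg
/-- Melkersson's criterion for a principal ideal. -/
theorem artinian_of_torsionBy {A : Type*} [CommRing A] {T : Type*} [AddCommGroup T] [Module A T]
    (x : A) (htor : ∀ t : T, ∃ k : ℕ, x ^ k • t = 0)
    (hart : IsArtinian A (LinearMap.ker (x • (LinearMap.id : T →ₗ[A] T)))) :
    IsArtinian A T := by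
  rw [← monotone_stabilizes_iff_artinian]
  intro N
  set K := LinearMap.ker (x • (LinearMap.id : T →ₗ[A] T)) with hK
  have memK : ∀ t, t ∈ K ↔ x • t = 0 := fun t => by simp [hK]
  let F : ℕ → ℕ → Submodule A K := fun j k =>
    Submodule.comap K.subtype (Submodule.map (x ^ k • (LinearMap.id : T →ₗ[A] T)) (OrderDual.ofDual (N j)))
  have memF : ∀ j k (t : K), t ∈ F j k ↔ ∃ y ∈ OrderDual.ofDual (N j), x ^ k • y = t := by
    intro j k t; simp [F]
  have hN : ∀ {j j'}, j ≤ j' → ∀ y ∈ OrderDual.ofDual (N j'), y ∈ OrderDual.ofDual (N j) := by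
    intro j j' h y hy
    exact (N.monotone h) hy
  have anti : ∀ {j j' k k'}, j ≤ j' → k ≤ k' → F j' k' ≤ F j k := by
    intro j j' k k' hj hk t ht
    rw [memF] at ht ⊢
    obtain ⟨y, hy, hyt⟩ := ht
    refine ⟨x ^ (k' - k) • y, Submodule.smul_mem _ _ (hN hj y hy), ?_⟩
    rw [smul_smul, ← pow_add, Nat.add_sub_cancel' hk, hyt]
  obtain ⟨j0, hj0⟩ := IsArtinian.monotone_stabilizes
    (⟨fun j => OrderDual.toDual (F j j), fun a b h => anti h h⟩ : ℕ →o (Submodule A K)ᵒᵈ)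
  have hk : ∀ k, ∃ n, ∀ m, n ≤ m → F n k = F m k := fun k =>
    IsArtinian.monotone_stabilizes
      (⟨fun j => OrderDual.toDual (F j k), fun a b h => anti h le_rfl⟩ : ℕ →o (Submodule A K)ᵒᵈ)
  choose n hn using hk
  have hj0' : ∀ m, j0 ≤ m → F j0 j0 = F m m := hj0
  let J := j0 + (Finset.range j0).sup n
  have hJn : ∀ k < j0, n k ≤ J := fun k hk =>
    (Finset.le_sup (f := n) (Finset.mem_range.2 hk)).trans (Nat.le_add_left _ _)
  have hJ0 : j0 ≤ J := Nat.le_add_right _ _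
  have hF : ∀ j, J ≤ j → ∀ k, F J k = F j k := by
    have key : ∀ j k, j0 ≤ j → j0 ≤ k → F j k = F j0 j0 := by
      intro j k hj hk
      apply le_antisymm (anti hj hk)
      rw [hj0' (max j k) (hj.trans (le_max_left _ _))]
      exact anti (le_max_left _ _) (le_max_right _ _)
    intro j hj k
    by_cases hkj : k < j0
    · rw [← hn k J (hJn k hkj), ← hn k j ((hJn k hkj).trans hj)]
    · rw [key J k hJ0 (not_lt.1 hkj), key j k (hJ0.trans hj) (not_lt.1 hkj)]
  refine ⟨J, fun j hj => ?_⟩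
  apply le_antisymm (N.monotone hj)
  change OrderDual.ofDual (N J) ≤ OrderDual.ofDual (N j)
  have claim : ∀ k : ℕ, ∀ y ∈ OrderDual.ofDual (N J), x ^ k • y = 0 → y ∈ OrderDual.ofDual (N j) := by
    intro k
    induction k with
    | zero => intro y hy h; simp at h; simp [h]
    | succ k ih =>
      intro y hy h
      have hm : x ^ k • y ∈ K := by rw [memK, smul_smul, ← pow_succ', h]
      have : (⟨_, hm⟩ : K) ∈ F J k := (memF _ _ _).2 ⟨y, hy, rfl⟩
      rw [hF j hj k, memF] at this
      obtain ⟨y', hy', h'⟩ := this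
      have := ih (y - y') (sub_mem hy (hN hj y' hy')) (by rw [smul_sub, h']; simp)
      have := add_mem this hy'
      simpa using this
  intro y hy
  obtain ⟨k, hk⟩ := htor y
  exact claim k y hy hk

theorem supIrred_dichotomy {A : Type*} [CommRing A] {T : Type*} [AddCommGroup T] [Module A T]
    [IsArtinian A T] (L : Submodule A T) (hL : SupIrred L) (r : A) :
    (∃ k : ℕ, ∀ y ∈ L, r ^ k • y = 0) ∨ (∀ y ∈ L, ∃ z ∈ L, r • z = y) := by
  let f : L →ₗ[A] L := r • LinearMap.id
  have hfp : ∀ (n : ℕ) (y : L), (f ^ n) y = r ^ n • y := by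
    intro n; induction n with
    | zero => simp
    | succ n ih => intro y; rw [pow_succ', Module.End.mul_apply, ih]; change r • (r ^ n • y) = _; rw [pow_succ', mul_smul]
  obtain ⟨n, hn⟩ := Filter.eventually_atTop.1 (LinearMap.eventually_codisjoint_ker_pow_range_pow f)
  have h := (hn (n+1) (Nat.le_succ n)).eq_top
  have h2 : Submodule.map L.subtype (LinearMap.ker (f ^ (n+1))) ⊔
      Submodule.map L.subtype (LinearMap.range (f ^ (n+1))) = L := by
    rw [← Submodule.map_sup, h]; simp
  rcases hL.2 h2 with h | h
  · left
    refine ⟨n+1, fun y hy => ?_⟩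
    rw [← h] at hy
    obtain ⟨z, hz, rfl⟩ := hy
    have := LinearMap.mem_ker.1 hz
    rw [hfp] at this
    exact congrArg Subtype.val this
  · right
    intro y hy
    rw [← h] at hy
    obtain ⟨z, ⟨w, rfl⟩, rfl⟩ := hy
    refine ⟨r ^ n • w, L.smul_mem _ w.2, ?_⟩
    rw [hfp, smul_smul, ← pow_succ']; rfl

theorem exists_good {R A : Type*} [CommRing R] [IsNoetherianRing R] [CommRing A] [Algebra R A]
    {T : Type*} [AddCommGroup T] [Module A T] [IsArtinian A T] (p q : Ideal R) [q.IsPrime]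
    (hpq : ¬ p ≤ q) :
    ∃ x ∈ p, x ∉ q ∧ ∃ c : ℕ, ∀ a ∈ p ^ c, ∀ t : T, ∃ z : T,
      algebraMap R A a • t = algebraMap R A x • z := by
  classical
  obtain ⟨s, hs, hirr⟩ := exists_supIrred_decomposition (⊤ : Submodule A T)
  let P : Submodule A T → Ideal R := fun L =>
    ((Module.annihilator A L).comap (algebraMap R A)).radical
  have memP : ∀ L r, r ∈ P L ↔ ∃ k : ℕ, ∀ y ∈ L, algebraMap R A r ^ k • y = 0 := by
    intro L r
    simp only [P, Ideal.mem_radical_iff, Ideal.mem_comap, Submodule.mem_annihilator, map_pow]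
  have hprime : ∀ L ∈ s, (P L).IsPrime := by
    intro L hL
    have hi := hirr hL
    refine ⟨?_, ?_⟩
    · intro h
      have : (1 : R) ∈ P L := h ▸ Submodule.mem_top
      obtain ⟨k, hk⟩ := (memP _ _).1 this
      exact hi.ne_bot ((Submodule.eq_bot_iff _).2 fun y hy => by simpa using hk y hy)
    · intro a b hab
      by_contra hcon
      push Not at hcon
      obtain ⟨ha, hb⟩ := hcon
      obtain ⟨k, hk⟩ := (memP _ _).1 hab
      have hsurj := (supIrred_dichotomy L hi (algebraMap R A a)).resolve_left (fun h => ha ((memP _ _).2 h))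
      have hsurjk : ∀ m : ℕ, ∀ y ∈ L, ∃ z ∈ L, algebraMap R A a ^ m • z = y := by
        intro m; induction m with
        | zero => intro y hy; exact ⟨y, hy, by simp⟩
        | succ m ih =>
          intro y hy
          obtain ⟨z, hz, rfl⟩ := hsurj y hy
          obtain ⟨w, hw, rfl⟩ := ih z hz
          exact ⟨w, hw, by rw [pow_succ', mul_smul]⟩
      refine hb ((memP _ _).2 ⟨k, fun y hy => ?_⟩)
      obtain ⟨z, hz, rfl⟩ := hsurjk k y hy
      rw [smul_smul, ← mul_pow, mul_comm, ← map_mul]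
      exact hk z hz
  let s' : Finset (Option (Submodule A T)) := insert none ((s.filter (fun L => ¬ p ≤ P L)).image some)
  let f : Option (Submodule A T) → Ideal R := fun o => o.elim q P
  have hav : ¬ ((p : Set R) ⊆ ⋃ i ∈ (s' : Set (Option (Submodule A T))), f i) := by
    intro h
    rw [Ideal.subset_union_prime (f := f) none none] at h
    · obtain ⟨i, hi, h⟩ := h
      simp only [s', Finset.mem_insert, Finset.mem_image, Finset.mem_filter] at hi
      rcases hi with rfl | ⟨L, ⟨-, hL⟩, rfl⟩
      · exact hpq h
      · exact hL h
    · intro i hi h1 h2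
      simp only [s', Finset.mem_insert, Finset.mem_image, Finset.mem_filter] at hi
      rcases hi with rfl | ⟨L, ⟨hL, -⟩, rfl⟩
      · exact absurd rfl h1
      · exact hprime L hL
  obtain ⟨x, hxp, hx⟩ := Set.not_subset.1 hav
  simp only [Set.mem_iUnion, not_exists] at hx
  have hc : ∀ L ∈ s, ∃ c : ℕ, p ≤ P L → ∀ a ∈ p ^ c, ∀ y ∈ L, algebraMap R A a • y = 0 := by
    intro L hL
    by_cases h : p ≤ P L
    · obtain ⟨c, hc⟩ := Ideal.exists_pow_le_of_le_radical_of_fg h ((isNoetherianRing_iff_ideal_fg R).1 inferInstance _)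
      refine ⟨c, fun _ a ha y hy => ?_⟩
      have := hc ha
      rw [Ideal.mem_comap, Submodule.mem_annihilator] at this
      exact this y hy
    · exact ⟨0, fun h' => absurd h' h⟩
  choose! c hc using hc
  refine ⟨x, hxp, ?_, s.sup c, ?_⟩
  · exact fun h => hx none (by simp [s']) h
  · intro a ha t
    have : (⊤ : Submodule A T) ≤ Submodule.comap (algebraMap R A a • LinearMap.id)
        (LinearMap.range (algebraMap R A x • (LinearMap.id : T →ₗ[A] T))) := by
      rw [← hs, Finset.sup_le_iff]
      intro L hL y hy
      change algebraMap R A a • y ∈ LinearMap.range (algebraMap R A x • (LinearMap.id : T →ₗ[A] T))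
      by_cases h : p ≤ P L
      · rw [hc L hL h a (Ideal.pow_le_pow_right (Finset.le_sup hL) ha) y hy]
        exact zero_mem _
      · have hxL : x ∉ P L := fun h' => hx (some L) (by simp [s', hL, h]) h'
        obtain ⟨z, hz, rfl⟩ := ((supIrred_dichotomy L (hirr hL) (algebraMap R A x)).resolve_left
          (fun h => hxL ((memP _ _).2 h))) y hy
        exact ⟨algebraMap R A a • z, by simp [smul_smul, mul_comm]⟩
    obtain ⟨z, hz⟩ := this (Submodule.mem_top (x := t))
    exact ⟨z, by simpa using hz.symm⟩
end alg

section chains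
variable {R : Type u} [CommRing R]

/-- There is a chain of primes of length `k` inside `[q, p]`. -/
def Ch (p : PrimeSpectrum R) (k : ℕ) (q : PrimeSpectrum R) : Prop :=
  ∃ l : LTSeries (PrimeSpectrum R), l.length = k ∧ q ≤ l.head ∧ l.last = p

theorem Ch.zero {p q : PrimeSpectrum R} (h : q ≤ p) : Ch p 0 q :=
  ⟨RelSeries.singleton _ p, rfl, h, rfl⟩

theorem Ch.le {p q : PrimeSpectrum R} {k : ℕ} (h : Ch p k q) : q ≤ p := by
  obtain ⟨l, -, h1, rfl⟩ := h
  exact h1.trans (LTSeries.head_le_last l)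

theorem Ch.succ {p q q' : PrimeSpectrum R} {k : ℕ} (hq : q < q') (h : Ch p k q') :
    Ch p (k + 1) q := by
  obtain ⟨l, rfl, h1, rfl⟩ := h
  exact ⟨l.cons q (hq.trans_le h1), by simp, by simp, by simp⟩

theorem Ch.exists_mem [IsNoetherianRing R] {p q : PrimeSpectrum R} {k : ℕ} (h : Ch p (k + 1) q)
    {x : R} (hx : x ∈ p.asIdeal) : ∃ q', q < q' ∧ x ∈ q'.asIdeal ∧ Ch p k q' := by
  obtain ⟨l, hl, h1, rfl⟩ := h
  obtain ⟨m, hm, h2, h3, h4⟩ := PrimeSpectrum.exist_ltSeries_mem_one_of_mem_last l hx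
  have hml : m.length ≠ 0 := by omega
  have : NeZero m.length := ⟨hml⟩
  have hlt : m.head < m 1 := m.strictMono (by
    rw [Fin.lt_def]; simp [Nat.mod_eq_of_lt (show 1 < m.length + 1 by omega)]; try omega)
  refine ⟨m 1, ?_, hm, m.tail hml, ?_, ?_, ?_⟩
  · exact (h1.trans h3.le).trans_lt hlt
  · simp; omega
  · simp
  · simp [h4]
end chains

/-- An abstract localized local cohomology theory. -/
structure LCT (R : Type u) [CommRing R] (p : PrimeSpectrum R) (A : Type u) [CommRing A]
    [Algebra R A] where
  T : ℕ → (M : Type u) → [AddCommGroup M] → [Module R M] → ModuleCat.{u} A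
  map : ∀ (i : ℕ) {M N : Type u} [AddCommGroup M] [Module R M] [AddCommGroup N] [Module R N]
    (_ : M →ₗ[R] N), T i M →ₗ[A] T i N
  map_smul_id : ∀ (i : ℕ) (M : Type u) [AddCommGroup M] [Module R M] (r : R) (x : T i M),
    map i (r • (LinearMap.id : M →ₗ[R] M)) x = algebraMap R A r • x
  map_comp : ∀ (i : ℕ) {M N Q : Type u} [AddCommGroup M] [Module R M] [AddCommGroup N] [Module R N]
    [AddCommGroup Q] [Module R Q] (f : M →ₗ[R] N) (g : N →ₗ[R] Q) (x : T i M),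
    map i (g ∘ₗ f) x = map i g (map i f x)
  exact₂ : ∀ (i : ℕ) {M N Q : Type u} [AddCommGroup M] [Module R M] [AddCommGroup N] [Module R N]
    [AddCommGroup Q] [Module R Q] (f : M →ₗ[R] N) (g : N →ₗ[R] Q), Function.Injective f →
    Function.Surjective g → Function.Exact f g → Function.Exact (map i f) (map i g)
  exactδ : ∀ (i : ℕ) {M N Q : Type u} [AddCommGroup M] [Module R M] [AddCommGroup N] [Module R N]
    [AddCommGroup Q] [Module R Q] (f : M →ₗ[R] N) (g : N →ₗ[R] Q), Function.Injective f →
    Function.Surjective g → Function.Exact f g →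
    ∃ δ : T i Q →ₗ[A] T (i + 1) M, Function.Exact (map i g) δ ∧ Function.Exact δ (map (i + 1) f)
  inj₀ : ∀ {M N : Type u} [AddCommGroup M] [Module R M] [AddCommGroup N] [Module R N]
    (f : M →ₗ[R] N), Function.Injective f → Function.Injective (map 0 f)
  torsion : ∀ (i : ℕ) (M : Type u) [AddCommGroup M] [Module R M] (x : T i M),
    ∃ c : ℕ, ∀ a ∈ p.asIdeal ^ c, algebraMap R A a • x = 0
  unit : ∀ s : R, s ∉ p.asIdeal → IsUnit (algebraMap R A s)
  vanish_p : ∀ i : ℕ, Subsingleton (T (i + 1) (R ⧸ p.asIdeal))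
  artinian_p : IsArtinian A (T 0 (R ⧸ p.asIdeal))
  nontrivial_p : Nontrivial (T 0 (R ⧸ p.asIdeal))

namespace LCT
variable {R : Type u} [CommRing R] {p : PrimeSpectrum R} {A : Type u} [CommRing A]
    [Algebra R A] (H : LCT R p A)

section
variable {M N : Type u} [AddCommGroup M] [Module R M] [AddCommGroup N] [Module R N]

theorem smul_eq_zero (i : ℕ) (r : R) (h : ∀ m : M, r • m = 0) (x : H.T i M) :
    algebraMap R A r • x = 0 := by
  rw [← H.map_smul_id]
  have : r • (LinearMap.id : M →ₗ[R] M) = (0 : R) • LinearMap.id := by ext m; simp [h m]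
  rw [this, H.map_smul_id]; simp

theorem subsingleton_of_smul (i : ℕ) (s : R) (hs : s ∉ p.asIdeal) (h : ∀ m : M, s • m = 0) :
    Subsingleton (H.T i M) := by
  refine subsingleton_of_forall_eq 0 fun x => ?_
  have := H.smul_eq_zero i s h x
  exact ((H.unit s hs).smul_eq_zero).1 this

theorem map_id (i : ℕ) (x : H.T i M) : H.map i (LinearMap.id : M →ₗ[R] M) x = x := by
  have := H.map_smul_id i M 1 x
  simpa using this

noncomputable def mapEquiv (i : ℕ) (e : M ≃ₗ[R] N) : H.T i M ≃ₗ[A] H.T i N :=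
  LinearEquiv.ofLinear (H.map i e.toLinearMap) (H.map i e.symm.toLinearMap)
    (by ext x; simp only [LinearMap.comp_apply]; rw [← H.map_comp]; simp [H.map_id])
    (by ext x; simp only [LinearMap.comp_apply]; rw [← H.map_comp]; simp [H.map_id])

end

section
variable (q : PrimeSpectrum R) (x : R)

/-- multiplication by `x` on `R/q` -/
abbrev mulq : (R ⧸ q.asIdeal) →ₗ[R] (R ⧸ q.asIdeal) := x • LinearMap.id

abbrev Qt : Type u := (R ⧸ q.asIdeal) ⧸ LinearMap.range (mulq q x)

theorem mulq_inj (hx : x ∉ q.asIdeal) : Function.Injective (mulq q x) := by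
  rw [injective_iff_map_eq_zero]
  intro m hm
  obtain ⟨m, rfl⟩ := Ideal.Quotient.mk_surjective m
  have : Ideal.Quotient.mk q.asIdeal (x * m) = 0 := by
    simpa [Algebra.smul_def] using hm
  rw [Ideal.Quotient.eq_zero_iff_mem] at this ⊢
  exact (q.2.mem_or_mem this).resolve_left hx

theorem mulq_exact : Function.Exact (mulq q x) (LinearMap.range (mulq q x)).mkQ :=
  LinearMap.exact_map_mkQ_range _

theorem Qt_q (a : R) (ha : a ∈ q.asIdeal) (m : Qt q x) : a • m = 0 := by
  obtain ⟨m, rfl⟩ := Submodule.mkQ_surjective _ m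
  obtain ⟨m, rfl⟩ := Ideal.Quotient.mk_surjective m
  rw [← map_smul]
  have : a • Ideal.Quotient.mk q.asIdeal m = 0 := by
    rw [Algebra.smul_def, Ideal.Quotient.algebraMap_eq, ← map_mul,
      Ideal.Quotient.eq_zero_iff_mem]
    exact Ideal.mul_mem_right _ _ ha
  rw [this, map_zero]

theorem Qt_x (m : Qt q x) : x • m = 0 := by
  obtain ⟨m, rfl⟩ := Submodule.mkQ_surjective _ m
  rw [← map_smul, Submodule.mkQ_apply, Submodule.Quotient.mk_eq_zero]
  exact ⟨m, by simp⟩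

theorem Qt_ann_gt (hx : x ∉ q.asIdeal) (q' : PrimeSpectrum R)
    (h : Module.annihilator R (Qt q x) ≤ q'.asIdeal) : q < q' := by
  have h1 : q ≤ q' := fun a ha => h (Module.mem_annihilator.2 (Qt_q q x a ha))
  refine lt_of_le_of_ne h1 ?_
  rintro rfl
  exact hx (h (Module.mem_annihilator.2 (Qt_x q x)))

end

variable [IsNoetherianRing R]

theorem tor_pow (i : ℕ) {M : Type u} [AddCommGroup M] [Module R M] {x : R} (hx : x ∈ p.asIdeal)
    (t : H.T i M) : ∃ k : ℕ, algebraMap R A x ^ k • t = 0 := by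
  obtain ⟨c, hc⟩ := H.torsion i M t
  exact ⟨c, by rw [← map_pow]; exact hc _ (Ideal.pow_mem_pow hx c)⟩

theorem zero_of_inj (i : ℕ) {M : Type u} [AddCommGroup M] [Module R M] {x : R}
    (hx : x ∈ p.asIdeal) (hinj : ∀ t : H.T i M, algebraMap R A x • t = 0 → t = 0) :
    Subsingleton (H.T i M) := by
  refine subsingleton_of_forall_eq 0 fun t => ?_
  obtain ⟨k, hk⟩ := H.tor_pow i hx t
  induction k with
  | zero => simpa using hk
  | succ k ih => exact ih (hinj _ (by rwa [smul_smul, ← pow_succ']))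

theorem T0_zero (q : PrimeSpectrum R) (hq : q < p) : Subsingleton (H.T 0 (R ⧸ q.asIdeal)) := by
  obtain ⟨x, hxp, hxq⟩ := Set.not_subset.1 (show ¬ (p.asIdeal : Set R) ⊆ q.asIdeal from hq.not_ge)
  refine H.zero_of_inj 0 hxp fun t ht => ?_
  rw [← H.map_smul_id] at ht
  exact H.inj₀ _ (mulq_inj q x hxq) (by rw [ht, map_zero])

theorem artinian (i : ℕ) : ∀ (M : Type u) [AddCommGroup M] [Module R M] [Module.Finite R M],
    IsArtinian A (H.T i M) := by
  induction i with
  | zero =>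
    intro M _ _ hM
    induction hM using IsNoetherianRing.induction_on_isQuotientEquivQuotientPrime R with
    | subsingleton N =>
      have := H.subsingleton_of_smul (M := N) 0 1 (p.asIdeal.ne_top_iff_one.1 p.2.ne_top) (fun m => Subsingleton.elim _ _)
      infer_instance
    | quotient N q e =>
      have : IsArtinian A (H.T 0 (R ⧸ q.asIdeal)) := by
        by_cases h : q ≤ p
        · rcases h.eq_or_lt with rfl | h
          · exact H.artinian_p
          · have := H.T0_zero q h
            infer_instance
        · obtain ⟨s, hs, hsp⟩ := Set.not_subset.1 (show ¬ (q.asIdeal : Set R) ⊆ p.asIdeal from h)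
          have := H.subsingleton_of_smul (M := R ⧸ q.asIdeal) 0 s hsp (fun m => by
            obtain ⟨m, rfl⟩ := Ideal.Quotient.mk_surjective m
            rw [Algebra.smul_def, Ideal.Quotient.algebraMap_eq, Ideal.Quotient.eq_zero_iff_mem.2 hs, zero_mul])
          infer_instance
      exact isArtinian_of_linearEquiv (H.mapEquiv 0 e).symm
    | exact N₁ N₂ N₃ f g hf hg hfg h₁ h₃ =>
      exact isArtinian_of_range_eq_ker _ _ (H.exact₂ 0 f g hf hg hfg).linearMap_ker_eq.symm
  | succ i ih =>
    intro M _ _ hM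
    induction hM using IsNoetherianRing.induction_on_isQuotientEquivQuotientPrime R with
    | subsingleton N =>
      have := H.subsingleton_of_smul (M := N) (i+1) 1 (p.asIdeal.ne_top_iff_one.1 p.2.ne_top) (fun m => Subsingleton.elim _ _)
      infer_instance
    | quotient N q e =>
      have : IsArtinian A (H.T (i+1) (R ⧸ q.asIdeal)) := by
        by_cases h : q ≤ p
        · rcases h.eq_or_lt with rfl | h
          · have := H.vanish_p i
            infer_instance
          · obtain ⟨x, hxp, hxq⟩ := Set.not_subset.1 (show ¬ (p.asIdeal : Set R) ⊆ q.asIdeal from h.not_ge)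
            obtain ⟨δ, h1, h2⟩ := H.exactδ i (mulq q x) _ (mulq_inj q x hxq) (Submodule.mkQ_surjective _) (mulq_exact q x)
            have := ih (Qt q x)
            refine artinian_of_torsionBy (algebraMap R A x) (H.tor_pow (i+1) hxp) ?_
            have hker : LinearMap.ker (algebraMap R A x • (LinearMap.id : H.T (i+1) (R ⧸ q.asIdeal) →ₗ[A] _))
                = LinearMap.range δ := by
              rw [← h2.linearMap_ker_eq]
              ext t
              simp only [LinearMap.mem_ker]
              rw [H.map_smul_id]; rfl
            rw [hker]
            exact isArtinian_of_surjective _ δ.rangeRestrict δ.surjective_rangeRestrict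
        · obtain ⟨s, hs, hsp⟩ := Set.not_subset.1 (show ¬ (q.asIdeal : Set R) ⊆ p.asIdeal from h)
          have := H.subsingleton_of_smul (M := R ⧸ q.asIdeal) (i+1) s hsp (fun m => by
            obtain ⟨m, rfl⟩ := Ideal.Quotient.mk_surjective m
            rw [Algebra.smul_def, Ideal.Quotient.algebraMap_eq, Ideal.Quotient.eq_zero_iff_mem.2 hs, zero_mul])
          infer_instance
      exact isArtinian_of_linearEquiv (H.mapEquiv (i+1) e).symm
    | exact N₁ N₂ N₃ f g hf hg hfg h₁ h₃ =>
      exact isArtinian_of_range_eq_ker _ _ (H.exact₂ (i+1) f g hf hg hfg).linearMap_ker_eq.symm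

theorem subsingleton_mid (i : ℕ) {M N Q : Type u} [AddCommGroup M] [Module R M] [AddCommGroup N]
    [Module R N] [AddCommGroup Q] [Module R Q] (f : M →ₗ[R] N) (g : N →ₗ[R] Q)
    (hf : Function.Injective f) (hg : Function.Surjective g) (hfg : Function.Exact f g)
    (h₁ : Subsingleton (H.T i M)) (h₃ : Subsingleton (H.T i Q)) : Subsingleton (H.T i N) := by
  refine subsingleton_of_forall_eq 0 fun t => ?_
  obtain ⟨y, rfl⟩ := (H.exact₂ i f g hf hg hfg t).1 (Subsingleton.elim _ _)
  rw [Subsingleton.elim y 0, map_zero]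

theorem vanish (k : ℕ) : ∀ (M : Type u) [AddCommGroup M] [Module R M] [Module.Finite R M],
    (∀ q : PrimeSpectrum R, Module.annihilator R M ≤ q.asIdeal → ¬ Ch p k q) →
    Subsingleton (H.T k M) := by
  induction k with
  | zero =>
    intro M _ _ hM
    induction hM using IsNoetherianRing.induction_on_isQuotientEquivQuotientPrime R with
    | subsingleton N =>
      intro _
      exact H.subsingleton_of_smul (M := N) 0 1 (p.asIdeal.ne_top_iff_one.1 p.2.ne_top) (fun m => Subsingleton.elim _ _)
    | quotient N q e =>
      intro h
      have hq : ¬ q ≤ p := fun hqp => h q (by rw [e.annihilator_eq, Ideal.annihilator_quotient]) (Ch.zero hqp)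
      obtain ⟨s, hs, hsp⟩ := Set.not_subset.1 (show ¬ (q.asIdeal : Set R) ⊆ p.asIdeal from hq)
      refine H.subsingleton_of_smul (M := N) 0 s hsp (fun m => ?_)
      have : s ∈ Module.annihilator R N := by rw [e.annihilator_eq, Ideal.annihilator_quotient]; exact hs
      exact Module.mem_annihilator.1 this m
    | exact N₁ N₂ N₃ f g hf hg hfg h₁ h₃ =>
      intro h
      exact H.subsingleton_mid 0 f g hf hg hfg
        (h₁ fun q hq => h q ((f.annihilator_le_of_injective hf).trans hq))
        (h₃ fun q hq => h q ((g.annihilator_le_of_surjective hg).trans hq))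
  | succ k ih =>
    intro M _ _ hM
    induction hM using IsNoetherianRing.induction_on_isQuotientEquivQuotientPrime R with
    | subsingleton N =>
      intro _
      exact H.subsingleton_of_smul (M := N) (k+1) 1 (p.asIdeal.ne_top_iff_one.1 p.2.ne_top) (fun m => Subsingleton.elim _ _)
    | quotient N q e =>
      intro h
      by_cases hq : q ≤ p
      · have hch : ¬ Ch p (k+1) q := h q (by rw [e.annihilator_eq, Ideal.annihilator_quotient])
        have : Subsingleton (H.T (k+1) (R ⧸ q.asIdeal)) := by
          rcases hq.eq_or_lt with rfl | hq
          · exact H.vanish_p k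
          · obtain ⟨x, hxp, hxq⟩ := Set.not_subset.1 (show ¬ (p.asIdeal : Set R) ⊆ q.asIdeal from hq.not_ge)
            obtain ⟨δ, h1, h2⟩ := H.exactδ k (mulq q x) _ (mulq_inj q x hxq) (Submodule.mkQ_surjective _) (mulq_exact q x)
            have hs : Subsingleton (H.T k (Qt q x)) := ih (Qt q x) fun q' hq' hc =>
              hch (Ch.succ (Qt_ann_gt q x hxq q' hq') hc)
            refine H.zero_of_inj (k+1) hxp fun t ht => ?_
            rw [← H.map_smul_id] at ht
            obtain ⟨y, rfl⟩ := (h2 t).1 ht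
            rw [Subsingleton.elim y 0, map_zero]
        exact (H.mapEquiv (k+1) e).toEquiv.subsingleton
      · obtain ⟨s, hs, hsp⟩ := Set.not_subset.1 (show ¬ (q.asIdeal : Set R) ⊆ p.asIdeal from hq)
        refine H.subsingleton_of_smul (M := N) (k+1) s hsp (fun m => ?_)
        have : s ∈ Module.annihilator R N := by rw [e.annihilator_eq, Ideal.annihilator_quotient]; exact hs
        exact Module.mem_annihilator.1 this m
    | exact N₁ N₂ N₃ f g hf hg hfg h₁ h₃ =>
      intro h
      exact H.subsingleton_mid (k+1) f g hf hg hfg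
        (h₁ fun q hq => h q ((f.annihilator_le_of_injective hf).trans hq))
        (h₃ fun q hq => h q ((g.annihilator_le_of_surjective hg).trans hq))

/-- Divisibility of the top module. -/
theorem divisible (n : ℕ) (q : PrimeSpectrum R) (hq : ¬ Ch p (n + 1) q) (x : R)
    (hx : x ∉ q.asIdeal) (t : H.T n (R ⧸ q.asIdeal)) : ∃ z, algebraMap R A x • z = t := by
  have hs : Subsingleton (H.T n (Qt q x)) := H.vanish n (Qt q x) fun q' hq' hc =>
    hq (Ch.succ (Qt_ann_gt q x hx q' hq') hc)
  obtain ⟨z, hz⟩ := (H.exact₂ n (mulq q x) _ (mulq_inj q x hx) (Submodule.mkQ_surjective _)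
    (mulq_exact q x) t).1 (Subsingleton.elim _ _)
  exact ⟨z, by rw [← H.map_smul_id, hz]⟩

theorem divisible_pow (n : ℕ) (q : PrimeSpectrum R) (hq : ¬ Ch p (n + 1) q) (x : R)
    (hx : x ∉ q.asIdeal) (c : ℕ) (t : H.T n (R ⧸ q.asIdeal)) :
    ∃ z, algebraMap R A (x ^ c) • z = t :=
  H.divisible n q hq _ (fun h => hx (q.2.mem_of_pow_mem c h)) t

theorem nonvanish (n : ℕ) : ∀ q : PrimeSpectrum R, Ch p n q → ¬ Ch p (n + 1) q →
    Nontrivial (H.T n (R ⧸ q.asIdeal)) := by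
  induction n with
  | zero =>
    intro q h0 h1
    have : q = p := by
      by_contra hne
      exact h1 (Ch.succ (lt_of_le_of_ne h0.le hne) (Ch.zero le_rfl))
    subst this
    exact H.nontrivial_p
  | succ n ih =>
    intro q hn hn1
    by_contra hcon
    rw [not_nontrivial_iff_subsingleton] at hcon
    have hqp : q < p := by
      obtain ⟨q', h, -, h'⟩ := hn.exists_mem (zero_mem p.asIdeal)
      exact h.trans_le h'.le
    have := H.artinian n (R ⧸ q.asIdeal)
    obtain ⟨x, hxp, hxq, c, hc⟩ := exists_good (R := R) (A := A) (T := H.T n (R ⧸ q.asIdeal)) p.asIdeal q.asIdeal hqp.not_ge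
    obtain ⟨q', hqq', hxq', hch⟩ := hn.exists_mem hxp
    have hch' : ¬ Ch p (n + 1) q' := fun h => hn1 (Ch.succ hqq' h)
    have hnt := ih q' hch hch'
    let g : Qt q x →ₗ[R] (R ⧸ q'.asIdeal) := Submodule.liftQ _ (Submodule.factor (show q.asIdeal ≤ q'.asIdeal from hqq'.le)) (by
      rintro _ ⟨m, rfl⟩
      obtain ⟨m, rfl⟩ := Ideal.Quotient.mk_surjective m
      rw [LinearMap.mem_ker]
      simp only [LinearMap.smul_apply, LinearMap.id_apply, map_smul]
      rw [Algebra.smul_def, Ideal.Quotient.algebraMap_eq, Ideal.Quotient.eq_zero_iff_mem.2 hxq', zero_mul])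
    have hg : Function.Surjective g := by
      intro y
      obtain ⟨m, rfl⟩ := Ideal.Quotient.mk_surjective y
      exact ⟨Submodule.Quotient.mk (Ideal.Quotient.mk _ m), rfl⟩
    obtain ⟨δ, h1, -⟩ := H.exactδ n (LinearMap.ker g).subtype g (Submodule.injective_subtype _) hg (LinearMap.exact_subtype_ker_map g)
    have hK : Subsingleton (H.T (n+1) (LinearMap.ker g)) := by
      refine H.vanish (n+1) _ fun q'' hq'' hc => ?_
      have : q < q'' := Qt_ann_gt q x hxq q''
        (((LinearMap.ker g).subtype.annihilator_le_of_injective (Submodule.injective_subtype _)).trans hq'')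
      exact hn1 (Ch.succ this hc)
    have hgs : Function.Surjective (H.map n g) := fun y => (h1 y).1 (Subsingleton.elim _ _)
    obtain ⟨δ', h1', -⟩ := H.exactδ n (mulq q x) _ (mulq_inj q x hxq) (Submodule.mkQ_surjective _) (mulq_exact q x)
    have hps : Function.Surjective (H.map n (LinearMap.range (mulq q x)).mkQ) :=
      fun y => (h1' y).1 (Subsingleton.elim _ _)
    have hkill : ∀ a ∈ p.asIdeal ^ c, ∀ y : H.T n (R ⧸ q'.asIdeal), algebraMap R A a • y = 0 := by
      intro a ha y
      obtain ⟨y, rfl⟩ := hgs y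
      obtain ⟨y, rfl⟩ := hps y
      obtain ⟨z, hz⟩ := hc a ha y
      rw [← map_smul, ← map_smul, hz, map_smul, H.smul_eq_zero n x (Qt_x q x), map_zero]
    rcases hch.le.eq_or_lt with rfl | hlt
    · -- here n = 0
      cases n with
      | zero =>
        have := H.T0_zero q hqp
        obtain ⟨y, hy⟩ := exists_ne (0 : H.T 0 (R ⧸ q'.asIdeal))
        obtain ⟨y, rfl⟩ := hgs y
        obtain ⟨y, rfl⟩ := hps y
        rw [Subsingleton.elim y 0] at hy
        simp at hy
      | succ n =>
        have := H.vanish_p n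
        exact not_subsingleton _ this
    · obtain ⟨y, hyp, hyq⟩ := Set.not_subset.1 (show ¬ (p.asIdeal : Set R) ⊆ q'.asIdeal from hlt.not_ge)
      obtain ⟨t, ht⟩ := exists_ne (0 : H.T n (R ⧸ q'.asIdeal))
      obtain ⟨z, rfl⟩ := H.divisible_pow n q' hch' y hyq c t
      exact ht (hkill _ (Ideal.pow_mem_pow hyp c) z)

theorem final [IsDomain R] (n : ℕ) (hn : Order.height p = n) (r : R)
    (hr : ∀ t : H.T n R, algebraMap R A r • t = 0) : r = 0 := by
  by_contra hr0
  let q : PrimeSpectrum R := ⊥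
  have hqb : q.asIdeal = ⊥ := rfl
  have hc : Ch p n q := by
    obtain ⟨l, hl, hl'⟩ := Order.exists_series_of_le_height p (n := n) hn.ge
    exact ⟨l, hl', bot_le, hl⟩
  have hc' : ¬ Ch p (n+1) q := by
    rintro ⟨l, hl, -, hl'⟩
    have := Order.length_le_height (p := l) (x := p) hl'.le
    rw [hl, hn] at this
    norm_cast at this
    omega
  have hnt := H.nonvanish n q hc hc'
  obtain ⟨t, ht⟩ := exists_ne (0 : H.T n (R ⧸ q.asIdeal))
  obtain ⟨z, rfl⟩ := H.divisible n q hc' r (by rw [hqb]; simpa using hr0) t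
  apply ht
  let e := H.mapEquiv n (Submodule.quotEquivOfEqBot q.asIdeal hqb)
  apply e.injective
  rw [map_smul, hr, map_zero]
end LCT
end aux

namespace LCC
open CategoryTheory CategoryTheory.Abelian
section
variable {R : Type u} [CommRing R] (I : Ideal R)

/-- The quotient `R/I^t` as an object of the category of modules. -/
noncomputable abbrev Qt (t : ℕ) : ModuleCat.{u} R := ModuleCat.of R (R ⧸ I ^ t)

/-- The canonical map `R/I^s → R/I^t`. -/
noncomputable def qmap {t s : ℕ} (h : t ≤ s) : Qt I s ⟶ Qt I t :=
  ModuleCat.ofHom (Submodule.mapQ _ _ LinearMap.id (Ideal.pow_le_pow_right h))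

theorem qmap_refl (t : ℕ) : qmap I (le_refl t) = 𝟙 _ := by
  ext; rfl

theorem qmap_comp {t s k : ℕ} (h : t ≤ s) (h' : s ≤ k) :
    qmap I h' ≫ qmap I h = qmap I (h.trans h') := by
  ext; rfl

/-- The module `Ext^i(R/I^t, M)`. -/
abbrev G (i : ℕ) (M : Type u) [AddCommGroup M] [Module R M] (t : ℕ) : Type u :=
  Ext (Qt I t) (ModuleCat.of R M) i

/-- transition maps. -/
noncomputable def tr (i : ℕ) (M : Type u) [AddCommGroup M] [Module R M] (t s : ℕ) (h : t ≤ s) :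
    G I i M t →ₗ[R] G I i M s :=
  Ext.precompOfLinear (Ext.mk₀ (qmap I h)) R _ (zero_add _)

theorem tr_apply (i : ℕ) (M : Type u) [AddCommGroup M] [Module R M] (t s : ℕ) (h : t ≤ s)
    (x : G I i M t) : tr I i M t s h x = (Ext.mk₀ (qmap I h)).comp x (zero_add _) := rfl

instance (i : ℕ) (M : Type u) [AddCommGroup M] [Module R M] :
    DirectedSystem (G I i M) (fun t s h => tr I i M t s h) where
  map_self t x := by rw [tr_apply, qmap_refl]; simp
  map_map t s k h h' x := by
    rw [tr_apply, tr_apply, tr_apply, ← qmap_comp I h h', ← Ext.mk₀_comp_mk₀,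
      Ext.comp_assoc_of_second_deg_zero]

/-- local cohomology as an explicit direct limit. -/
abbrev Hh (i : ℕ) (M : Type u) [AddCommGroup M] [Module R M] : Type u :=
  Module.DirectLimit (G I i M) (tr I i M)

/-- canonical maps. -/
noncomputable abbrev ofH (i : ℕ) (M : Type u) [AddCommGroup M] [Module R M] (t : ℕ) :
    G I i M t →ₗ[R] Hh I i M := Module.DirectLimit.of R ℕ (G I i M) (tr I i M) t

theorem exists_ofH (i : ℕ) (M : Type u) [AddCommGroup M] [Module R M] (x : Hh I i M) :
    ∃ t y, ofH I i M t y = x := Module.DirectLimit.exists_of x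

theorem ofH_tr (i : ℕ) (M : Type u) [AddCommGroup M] [Module R M] (t s : ℕ) (h : t ≤ s)
    (x : G I i M t) : ofH I i M s (tr I i M t s h x) = ofH I i M t x :=
  Module.DirectLimit.of_f

theorem ofH_eq_zero (i : ℕ) (M : Type u) [AddCommGroup M] [Module R M] (t : ℕ) (x : G I i M t)
    (hx : ofH I i M t x = 0) : ∃ s h, tr I i M t s h x = 0 := Module.DirectLimit.of.zero_exact hx

section
variable {M N Q : Type u} [AddCommGroup M] [Module R M] [AddCommGroup N] [Module R N]
    [AddCommGroup Q] [Module R Q]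

/-- functoriality at finite stage. -/
noncomputable def pc (i : ℕ) (f : M →ₗ[R] N) (t : ℕ) : G I i M t →ₗ[R] G I i N t :=
  Ext.postcompOfLinear (Ext.mk₀ (ModuleCat.ofHom f)) R _ (add_zero _)

theorem pc_apply (i : ℕ) (f : M →ₗ[R] N) (t : ℕ) (x : G I i M t) :
    pc I i f t x = x.comp (Ext.mk₀ (ModuleCat.ofHom f)) (add_zero _) := rfl

/-- functoriality. -/
noncomputable def mapH (i : ℕ) (f : M →ₗ[R] N) : Hh I i M →ₗ[R] Hh I i N :=
  Module.DirectLimit.map (pc I i f) (by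
    intro t s h
    ext x
    simp only [LinearMap.comp_apply, pc_apply, tr_apply]
    rw [Ext.comp_assoc_of_third_deg_zero])

theorem mapH_of (i : ℕ) (f : M →ₗ[R] N) (t : ℕ) (x : G I i M t) :
    mapH I i f (ofH I i M t x) = ofH I i N t (pc I i f t x) :=
  Module.DirectLimit.map_apply_of _ _ _

theorem tr_pc (i : ℕ) (f : M →ₗ[R] N) (t s : ℕ) (h : t ≤ s) (x : G I i M t) :
    tr I i N t s h (pc I i f t x) = pc I i f s (tr I i M t s h x) := by
  simp only [pc_apply, tr_apply]
  rw [Ext.comp_assoc_of_third_deg_zero]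

theorem mapH_comp (i : ℕ) (f : M →ₗ[R] N) (g : N →ₗ[R] Q) (x : Hh I i M) :
    mapH I i (g ∘ₗ f) x = mapH I i g (mapH I i f x) := by
  obtain ⟨t, y, rfl⟩ := exists_ofH I i M x
  simp only [mapH_of, pc_apply]
  rw [Ext.comp_assoc_of_third_deg_zero, Ext.mk₀_comp_mk₀]
  rfl

theorem mapH_smul_id (i : ℕ) (r : R) (x : Hh I i M) :
    mapH I i (r • (LinearMap.id : M →ₗ[R] M)) x = r • x := by
  obtain ⟨t, y, rfl⟩ := exists_ofH I i M x
  rw [mapH_of, ← map_smul, Ext.smul_eq_comp_mk₀, pc_apply]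
  rfl

theorem mapH_id (i : ℕ) (x : Hh I i M) :
    mapH I i (LinearMap.id : M →ₗ[R] M) x = x := by
  have := mapH_smul_id I i (1 : R) x
  simpa using this

theorem mapH_zero (i : ℕ) (x : Hh I i M) :
    mapH I i (0 : M →ₗ[R] N) x = 0 := by
  obtain ⟨t, y, rfl⟩ := exists_ofH I i M x
  rw [mapH_of, pc_apply]
  simp

/-- the short complex of modules. -/
abbrev SC (f : M →ₗ[R] N) (g : N →ₗ[R] Q) (h : Function.Exact f g) :
    ShortComplex (ModuleCat.{u} R) :=
  ShortComplex.mk (ModuleCat.ofHom f) (ModuleCat.ofHom g) (by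
    ext x; exact h.apply_apply_eq_zero x)

theorem SC_exact (f : M →ₗ[R] N) (g : N →ₗ[R] Q) (hf : Function.Injective f)
    (hg : Function.Surjective g) (h : Function.Exact f g) : (SC f g h).ShortExact where
  exact := (ShortComplex.ShortExact.moduleCat_exact_iff_function_exact _).2 h
  mono_f := (ModuleCat.mono_iff_injective _).2 hf
  epi_g := (ModuleCat.epi_iff_surjective _).2 hg

theorem mapH_exact (i : ℕ) (f : M →ₗ[R] N) (g : N →ₗ[R] Q) (hf : Function.Injective f)
    (hg : Function.Surjective g) (h : Function.Exact f g) :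
    Function.Exact (mapH I i f) (mapH I i g) := by
  intro x
  constructor
  · intro hx
    obtain ⟨t, y, rfl⟩ := exists_ofH I i N x
    rw [mapH_of] at hx
    obtain ⟨s, hs, hy⟩ := ofH_eq_zero I i Q t _ hx
    rw [tr_pc] at hy
    obtain ⟨z, hz⟩ := Ext.covariant_sequence_exact₂ _ (SC_exact f g hf hg h) _ hy
    refine ⟨ofH I i M s z, ?_⟩
    rw [mapH_of, ← ofH_tr I i N t s hs y, ← hz]
    rfl
  · rintro ⟨y, rfl⟩
    rw [← mapH_comp, h.linearMap_comp_eq_zero, mapH_zero]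

/-- finite stage of the connecting map -/
noncomputable def dl (i : ℕ) (f : M →ₗ[R] N) (g : N →ₗ[R] Q) (hf : Function.Injective f)
    (hg : Function.Surjective g) (h : Function.Exact f g) (t : ℕ) : G I i Q t →ₗ[R] G I (i+1) M t :=
  Ext.postcompOfLinear (SC_exact f g hf hg h).extClass R _ rfl

theorem dl_apply (i : ℕ) (f : M →ₗ[R] N) (g : N →ₗ[R] Q) (hf : Function.Injective f)
    (hg : Function.Surjective g) (h : Function.Exact f g) (t : ℕ) (x : G I i Q t) :
    dl I i f g hf hg h t x = x.comp (SC_exact f g hf hg h).extClass rfl := rfl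

theorem tr_dl (i : ℕ) (f : M →ₗ[R] N) (g : N →ₗ[R] Q) (hf : Function.Injective f)
    (hg : Function.Surjective g) (h : Function.Exact f g) (t s : ℕ) (hs : t ≤ s) (x : G I i Q t) :
    tr I (i+1) M t s hs (dl I i f g hf hg h t x) = dl I i f g hf hg h s (tr I i Q t s hs x) := by
  simp only [dl_apply, tr_apply]
  rw [Ext.comp_assoc]
  simp

/-- connecting map -/
noncomputable def dH (i : ℕ) (f : M →ₗ[R] N) (g : N →ₗ[R] Q) (hf : Function.Injective f)
    (hg : Function.Surjective g) (h : Function.Exact f g) : Hh I i Q →ₗ[R] Hh I (i+1) M :=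
  Module.DirectLimit.map (dl I i f g hf hg h) (by
    intro t s hs
    ext x
    exact (tr_dl I i f g hf hg h t s hs x).symm)

theorem dH_of (i : ℕ) (f : M →ₗ[R] N) (g : N →ₗ[R] Q) (hf : Function.Injective f)
    (hg : Function.Surjective g) (h : Function.Exact f g) (t : ℕ) (x : G I i Q t) :
    dH I i f g hf hg h (ofH I i Q t x) = ofH I (i+1) M t (dl I i f g hf hg h t x) :=
  Module.DirectLimit.map_apply_of _ _ _

theorem dH_exact₁ (i : ℕ) (f : M →ₗ[R] N) (g : N →ₗ[R] Q) (hf : Function.Injective f)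
    (hg : Function.Surjective g) (h : Function.Exact f g) :
    Function.Exact (mapH I i g) (dH I i f g hf hg h) := by
  intro x
  constructor
  · intro hx
    obtain ⟨t, y, rfl⟩ := exists_ofH I i Q x
    rw [dH_of] at hx
    obtain ⟨s, hs, hy⟩ := ofH_eq_zero I _ M t _ hx
    rw [tr_dl] at hy
    obtain ⟨z, hz⟩ := Ext.covariant_sequence_exact₃ _ (SC_exact f g hf hg h) _ rfl hy
    refine ⟨ofH I i N s z, ?_⟩
    rw [mapH_of, ← ofH_tr I i Q t s hs y, ← hz]
    rfl
  · rintro ⟨y, rfl⟩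
    obtain ⟨t, y, rfl⟩ := exists_ofH I i N y
    rw [mapH_of, dH_of, pc_apply, dl_apply, Ext.comp_assoc_of_second_deg_zero]
    have := (SC_exact f g hf hg h).comp_extClass
    dsimp only [SC] at this
    rw [this]
    simp

theorem dH_exact₂ (i : ℕ) (f : M →ₗ[R] N) (g : N →ₗ[R] Q) (hf : Function.Injective f)
    (hg : Function.Surjective g) (h : Function.Exact f g) :
    Function.Exact (dH I i f g hf hg h) (mapH I (i+1) f) := by
  intro x
  constructor
  · intro hx
    obtain ⟨t, y, rfl⟩ := exists_ofH I _ M x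
    rw [mapH_of] at hx
    obtain ⟨s, hs, hy⟩ := ofH_eq_zero I _ N t _ hx
    rw [tr_pc] at hy
    obtain ⟨z, hz⟩ := Ext.covariant_sequence_exact₁ _ (SC_exact f g hf hg h) _ hy rfl
    refine ⟨ofH I i Q s z, ?_⟩
    rw [dH_of, ← ofH_tr I _ M t s hs y, ← hz]
    rfl
  · rintro ⟨y, rfl⟩
    obtain ⟨t, y, rfl⟩ := exists_ofH I i Q y
    rw [dH_of, mapH_of, pc_apply, dl_apply, Ext.comp_assoc_of_third_deg_zero]
    have := (SC_exact f g hf hg h).extClass_comp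
    dsimp only [SC] at this
    rw [this]
    simp

theorem mapH_inj (f : M →ₗ[R] N) (hf : Function.Injective f) :
    Function.Injective (mapH I 0 f) := by
  rw [injective_iff_map_eq_zero]
  intro x hx
  obtain ⟨t, y, rfl⟩ := exists_ofH I _ M x
  rw [mapH_of] at hx
  obtain ⟨s, hs, hy⟩ := ofH_eq_zero I _ N t _ hx
  rw [tr_pc] at hy
  rw [← ofH_tr I _ M t s hs]
  have : Mono (ModuleCat.ofHom f) := (ModuleCat.mono_iff_injective _).2 hf
  have h2 := Ext.postcomp_mk₀_injective_of_mono (Qt I s) (ModuleCat.ofHom f)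
  have h3 : tr I 0 M t s hs y = 0 := h2 (hy.trans (by simp))
  rw [h3, map_zero]

theorem pow_smul_H (i : ℕ) (x : Hh I i M) : ∃ t, ∀ a ∈ I ^ t, a • x = 0 := by
  obtain ⟨t, y, rfl⟩ := exists_ofH I _ M x
  refine ⟨t, fun a ha => ?_⟩
  rw [← map_smul]
  have : a • y = ((Ext.mk₀ (a • 𝟙 (Qt I t))).comp y (zero_add _)) := by
    rw [Ext.mk₀_smul, Ext.smul_comp]; simp
  rw [this]
  have h0 : a • 𝟙 (Qt I t) = 0 := by
    apply ModuleCat.hom_ext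
    apply LinearMap.ext
    intro x
    obtain ⟨x, rfl⟩ := Ideal.Quotient.mk_surjective x
    change a • Ideal.Quotient.mk (I ^ t) x = 0
    rw [← Ideal.Quotient.mk_eq_mk, ← Submodule.Quotient.mk_smul, Submodule.Quotient.mk_eq_zero]
    exact Ideal.mul_mem_right _ _ ha
  rw [h0]; simp

end
end
end LCC

namespace LCC
open CategoryTheory CategoryTheory.Abelian
section
variable {R : Type u} [CommRing R] (I : Ideal R)

/-- `I`-power torsion modules -/
def Tors (M : Type u) [AddCommGroup M] [Module R M] : Prop :=
  ∀ x : M, ∃ t : ℕ, ∀ a ∈ I ^ t, a • x = 0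

/-- the `I`-power torsion submodule -/
def Gam (M : Type u) [AddCommGroup M] [Module R M] : Submodule R M where
  carrier := {x | ∃ t : ℕ, ∀ a ∈ I ^ t, a • x = 0}
  zero_mem' := ⟨0, fun a _ => smul_zero a⟩
  add_mem' := by
    rintro x y ⟨t, ht⟩ ⟨s, hs⟩
    refine ⟨t + s, fun a ha => ?_⟩
    rw [smul_add, ht a (Ideal.pow_le_pow_right (Nat.le_add_right _ _) ha),
      hs a (Ideal.pow_le_pow_right (Nat.le_add_left _ _) ha), add_zero]
  smul_mem' := by
    rintro c x ⟨t, ht⟩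
    refine ⟨t, fun a ha => ?_⟩
    rw [smul_comm, ht a ha, smul_zero]

theorem mem_Gam {M : Type u} [AddCommGroup M] [Module R M] (x : M) :
    x ∈ Gam I M ↔ ∃ t : ℕ, ∀ a ∈ I ^ t, a • x = 0 := Iff.rfl

theorem tors_Gam (M : Type u) [AddCommGroup M] [Module R M] : Tors I (Gam I M) := by
  rintro ⟨x, t, ht⟩
  exact ⟨t, fun a ha => Subtype.ext (ht a ha)⟩

section
variable {M N Q : Type u} [AddCommGroup M] [Module R M] [AddCommGroup N] [Module R N]
    [AddCommGroup Q] [Module R Q]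

theorem Tors.of_surj (h : Tors I M) (f : M →ₗ[R] N) (hf : Function.Surjective f) : Tors I N := by
  intro y
  obtain ⟨x, rfl⟩ := hf y
  obtain ⟨t, ht⟩ := h x
  exact ⟨t, fun a ha => by rw [← map_smul, ht a ha, map_zero]⟩

/-- evaluation at one -/
noncomputable def ev (M : Type u) [AddCommGroup M] [Module R M] (t : ℕ) : G I 0 M t →ₗ[R] M :=
  (LinearMap.applyₗ (Ideal.Quotient.mk (I ^ t) 1 : R ⧸ I ^ t)) ∘ₗ
    (ModuleCat.homLinearEquiv (R := R) (S := R)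
      (M := Qt I t) (N := ModuleCat.of R M)).toLinearMap ∘ₗ
    (Ext.linearEquiv₀ (R := R) (X := Qt I t) (Y := ModuleCat.of R M)).toLinearMap

theorem ev_mk₀ (t : ℕ) (f : (R ⧸ I ^ t) →ₗ[R] M) :
    ev I M t (Ext.mk₀ (ModuleCat.ofHom f)) = f (Ideal.Quotient.mk (I ^ t) 1) := by
  have : (Ext.linearEquiv₀ (R := R) (X := Qt I t) (Y := ModuleCat.of R M))
      (Ext.mk₀ (ModuleCat.ofHom f)) = ModuleCat.ofHom f := by
    apply (Ext.linearEquiv₀ (R := R) (X := Qt I t) (Y := ModuleCat.of R M)).symm.injective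
    simp
  simp only [ev, LinearMap.comp_apply, LinearEquiv.coe_coe, this]
  rfl

theorem exists_mk₀ (t : ℕ) (y : G I 0 M t) :
    ∃ f : (R ⧸ I ^ t) →ₗ[R] M, y = Ext.mk₀ (ModuleCat.ofHom f) :=
  ⟨((Ext.linearEquiv₀ (R := R)) y).hom, (Ext.mk₀_linearEquiv₀_apply (R := R) y).symm⟩

theorem tr_mk₀ (t s : ℕ) (h : t ≤ s) (f : (R ⧸ I ^ t) →ₗ[R] M) :
    tr I 0 M t s h (Ext.mk₀ (ModuleCat.ofHom f)) = Ext.mk₀ (ModuleCat.ofHom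
      (f ∘ₗ (Submodule.mapQ _ _ LinearMap.id (Ideal.pow_le_pow_right h)))) := by
  rw [tr_apply, Ext.mk₀_comp_mk₀]
  rfl

/-- evaluation map in the limit -/
noncomputable def evH (M : Type u) [AddCommGroup M] [Module R M] : Hh I 0 M →ₗ[R] M :=
  Module.DirectLimit.lift R ℕ _ _ (ev I M) (by
    intro t s h y
    obtain ⟨f, rfl⟩ := exists_mk₀ I t y
    rw [tr_mk₀, ev_mk₀, ev_mk₀]
    rfl)

theorem evH_of (t : ℕ) (y : G I 0 M t) : evH I M (ofH I 0 M t y) = ev I M t y :=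
  Module.DirectLimit.lift_of _ _ _

theorem evH_injective : Function.Injective (evH I M) := by
  rw [injective_iff_map_eq_zero]
  intro x hx
  obtain ⟨t, y, rfl⟩ := exists_ofH I _ M x
  obtain ⟨f, rfl⟩ := exists_mk₀ I t y
  rw [evH_of, ev_mk₀] at hx
  have : f = 0 := by
    apply LinearMap.ext
    intro z
    obtain ⟨z, rfl⟩ := Ideal.Quotient.mk_surjective z
    have : Ideal.Quotient.mk (I ^ t) z = z • Ideal.Quotient.mk (I ^ t) 1 := by
      rw [← Ideal.Quotient.mk_eq_mk, ← Ideal.Quotient.mk_eq_mk, ← Submodule.Quotient.mk_smul]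
      simp
    rw [this, map_smul, hx, smul_zero]; rfl
  rw [this]
  simp

theorem evH_surjective (h : Tors I M) : Function.Surjective (evH I M) := by
  intro x
  obtain ⟨t, ht⟩ := h x
  refine ⟨ofH I 0 M t (Ext.mk₀ (ModuleCat.ofHom
    (Submodule.liftQ (I ^ t) (LinearMap.toSpanSingleton R M x) (fun a ha => ht a ha)))), ?_⟩
  rw [evH_of, ev_mk₀]
  change (1 : R) • x = x
  simp

theorem evH_nat (f : M →ₗ[R] N) (x : Hh I 0 M) : evH I N (mapH I 0 f x) = f (evH I M x) := by
  obtain ⟨t, y, rfl⟩ := exists_ofH I _ M x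
  obtain ⟨g, rfl⟩ := exists_mk₀ I t y
  rw [mapH_of, evH_of, evH_of, pc_apply, Ext.mk₀_comp_mk₀, ev_mk₀]
  exact ev_mk₀ I t (f ∘ₗ g)

theorem mapH_surj (h : Tors I M) (f : M →ₗ[R] N) (hf : Function.Surjective f) :
    Function.Surjective (mapH I 0 f) := by
  intro y
  obtain ⟨x, hx⟩ := hf (evH I N y)
  obtain ⟨z, rfl⟩ := evH_surjective I h x
  exact ⟨z, evH_injective I (by rw [evH_nat, hx])⟩

theorem baer_Gam [IsNoetherianRing R] (E : Type u) [AddCommGroup E] [Module R E]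
    [Module.Injective R E] : Module.Baer R (Gam I E) := by
  intro J f
  -- a uniform power killing the image
  have key : ∃ t, ∀ a ∈ I ^ t, ∀ j : J, a • f j = 0 := by
    have hfg : (⊤ : Submodule R J).FG := IsNoetherian.noetherian _
    obtain ⟨S, hS⟩ := hfg
    choose c hc using fun j : J => tors_Gam I E (f j)
    refine ⟨S.sup c, fun a ha j => ?_⟩
    have hj : j ∈ Submodule.span R (S : Set J) := by rw [hS]; trivial
    induction hj using Submodule.span_induction with
    | mem x hx => exact hc x a (Ideal.pow_le_pow_right (Finset.le_sup (f := c) hx) ha)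
    | zero => simp
    | add x y _ _ hx hy => rw [map_add, smul_add, hx, hy, add_zero]
    | smul r x _ hx => rw [map_smul, smul_comm, hx, smul_zero]
  obtain ⟨t, ht⟩ := key
  obtain ⟨k, hk⟩ := Ideal.exists_pow_inf_eq_pow_smul I J
  have hAR : ∀ j : J, (j : R) ∈ I ^ (k + t) → f j = 0 := by
    intro j hj
    have h1 : (j : R) ∈ I ^ t • (J : Submodule R R) := by
      have h2 : (j : R) ∈ I ^ (k + t) • (⊤ : Submodule R R) ⊓ J := by
        refine ⟨?_, j.2⟩
        have := Submodule.smul_mem_smul hj (Submodule.mem_top (x := (1 : R)))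
        simpa using this
      rw [hk (k + t) (Nat.le_add_right _ _), Nat.add_sub_cancel_left] at h2
      exact Submodule.smul_mono le_rfl inf_le_right h2
    have h3 : ∀ z (hz : z ∈ I ^ t • (J : Submodule R R)) (hz' : z ∈ J), f ⟨z, hz'⟩ = 0 := by
      intro z hz
      induction hz using Submodule.smul_induction_on' with
      | smul a ha n hn =>
        intro hz'
        have : (⟨a • n, hz'⟩ : J) = a • ⟨n, hn⟩ := rfl
        rw [this, map_smul, ht a ha]
      | add x hx y hy hx' hy' =>
        intro hz'
        have hxJ : x ∈ J := Submodule.smul_le_right hx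
        have hyJ : y ∈ J := Submodule.smul_le_right hy
        have : (⟨x + y, hz'⟩ : J) = ⟨x, hxJ⟩ + ⟨y, hyJ⟩ := rfl
        rw [this, map_add, hx', hy', add_zero]
    exact h3 j h1 j.2
  let u : J →ₗ[R] R ⧸ I ^ (k + t) := (Submodule.mkQ (I ^ (k + t))) ∘ₗ J.subtype
  have hker : LinearMap.ker u ≤ LinearMap.ker ((Gam I E).subtype ∘ₗ f) := by
    intro j hj
    have : (j : R) ∈ I ^ (k + t) := by
      rw [LinearMap.mem_ker] at hj
      exact (Submodule.Quotient.mk_eq_zero _).1 hj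
    simp [hAR j this]
  obtain ⟨g, hg⟩ := Module.Injective.out (Q := E) ((LinearMap.ker u).liftQ u le_rfl)
    (LinearMap.ker_eq_bot.1 (by rw [Submodule.ker_liftQ_eq_bot]; exact le_rfl))
    ((LinearMap.ker u).liftQ _ hker)
  have hg' : ∀ j : J, g (Ideal.Quotient.mk _ (j : R)) = f j := fun j => hg (Submodule.Quotient.mk j)
  have hsm : ∀ z : R, Ideal.Quotient.mk (I ^ (k+t)) z = z • Ideal.Quotient.mk (I ^ (k+t)) 1 := by
    intro z
    rw [← Ideal.Quotient.mk_eq_mk, ← Ideal.Quotient.mk_eq_mk, ← Submodule.Quotient.mk_smul]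
    simp
  have he : g (Ideal.Quotient.mk _ 1) ∈ Gam I E := by
    refine ⟨k + t, fun a ha => ?_⟩
    rw [← map_smul, ← hsm, Ideal.Quotient.eq_zero_iff_mem.2 ha, map_zero]
  refine ⟨LinearMap.toSpanSingleton R _ ⟨_, he⟩, fun x hx => ?_⟩
  apply Subtype.ext
  rw [← hg' ⟨x, hx⟩, hsm x, map_smul]
  rfl

theorem H_inj [Module.Injective R M] (i : ℕ) : Subsingleton (Hh I (i + 1) M) := by
  refine ⟨fun x y => ?_⟩
  have : ∀ x : Hh I (i + 1) M, x = 0 := by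
    intro x
    obtain ⟨t, y, rfl⟩ := exists_ofH I _ M x
    have : Injective (ModuleCat.of R M) := (Module.injective_iff_injective_object R M).1 inferInstance
    rw [Ext.eq_zero_of_injective y, map_zero]
  rw [this x, this y]

theorem exists_emb [IsNoetherianRing R] (M : Type u) [AddCommGroup M] [Module R M]
    (hM : Tors I M) : ∃ (E : ModuleCat.{u} R) (f : M →ₗ[R] E), Function.Injective f ∧
      Tors I E ∧ Module.Injective R E := by
  let E := Injective.under (ModuleCat.of R M)
  let ι : M →ₗ[R] E := (Injective.ι (ModuleCat.of R M)).hom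
  have hι : Function.Injective ι := (ModuleCat.mono_iff_injective (Injective.ι (ModuleCat.of R M))).1
    inferInstance
  have : Module.Injective R E := (Module.injective_iff_injective_object R E).2
    (inferInstanceAs (Injective (Injective.under (ModuleCat.of R M))))
  refine ⟨ModuleCat.of R (Gam I E), ι.codRestrict (Gam I E) ?_, ?_, tors_Gam I E,
    (baer_Gam I E).injective⟩
  · intro x
    obtain ⟨t, ht⟩ := hM x
    exact ⟨t, fun a ha => by rw [← map_smul, ht a ha, map_zero]⟩
  · intro x y h
    exact hι (congrArg Subtype.val h)

theorem H_tors [IsNoetherianRing R] (i : ℕ) : ∀ (M : Type u) [AddCommGroup M] [Module R M],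
    Tors I M → Subsingleton (Hh I (i + 1) M) := by
  induction i with
  | zero =>
    intro M _ _ hM
    obtain ⟨E, f, hf, hE, hinj⟩ := exists_emb I M hM
    have hg := Submodule.mkQ_surjective (LinearMap.range f)
    have hex : Function.Exact f (LinearMap.range f).mkQ := LinearMap.exact_map_mkQ_range f
    have h0 := H_inj I (M := E) 0
    refine subsingleton_of_forall_eq 0 fun x => ?_
    obtain ⟨y, rfl⟩ := (dH_exact₂ I 0 f _ hf hg hex x).1 (Subsingleton.elim _ _)
    exact (dH_exact₁ I 0 f _ hf hg hex y).2 (mapH_surj I hE _ hg y)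
  | succ i ih =>
    intro M _ _ hM
    obtain ⟨E, f, hf, hE, hinj⟩ := exists_emb I M hM
    have hg := Submodule.mkQ_surjective (LinearMap.range f)
    have hex : Function.Exact f (LinearMap.range f).mkQ := LinearMap.exact_map_mkQ_range f
    have h0 := H_inj I (M := E) (i + 1)
    have h1 := ih _ (Tors.of_surj I hE _ hg)
    refine subsingleton_of_forall_eq 0 fun x => ?_
    obtain ⟨y, rfl⟩ := (dH_exact₂ I (i + 1) f _ hf hg hex x).1 (Subsingleton.elim _ _)
    rw [Subsingleton.elim y 0, map_zero]

end
end
end LCC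

namespace LCC
open CategoryTheory CategoryTheory.Abelian
section
variable {R : Type u} [CommRing R] (I : Ideal R)

theorem loc_exact (S : Submonoid R) {M N Q : Type u} [AddCommGroup M] [Module R M]
    [AddCommGroup N] [Module R N] [AddCommGroup Q] [Module R Q] (f : M →ₗ[R] N) (g : N →ₗ[R] Q)
    (h : Function.Exact f g) :
    Function.Exact (LocalizedModule.map S f) (LocalizedModule.map S g) :=
  LocalizedModule.map_exact S f g h

theorem loc_simple (p : PrimeSpectrum R) :
    IsSimpleModule (Localization p.asIdeal.primeCompl)
      (LocalizedModule p.asIdeal.primeCompl (R ⧸ p.asIdeal)) := by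
  rw [isSimpleModule_iff_toSpanSingleton_surjective]
  constructor
  · refine ⟨LocalizedModule.mk (Ideal.Quotient.mk _ 1) 1, 0, fun h => ?_⟩
    rw [← LocalizedModule.zero_mk 1, LocalizedModule.mk_eq] at h
    obtain ⟨s, hs⟩ := h
    simp only [one_smul, smul_zero] at hs
    refine s.2 ?_
    rw [SetLike.mem_coe, ← Ideal.Quotient.eq_zero_iff_mem]
    rw [← hs, Submonoid.smul_def, ← Ideal.Quotient.mk_eq_mk, ← Ideal.Quotient.mk_eq_mk,
      ← Submodule.Quotient.mk_smul]
    simp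
  · intro x hx y
    induction x using LocalizedModule.induction_on with | _ m s
    induction y using LocalizedModule.induction_on with | _ n t
    obtain ⟨m, rfl⟩ := Ideal.Quotient.mk_surjective m
    obtain ⟨n, rfl⟩ := Ideal.Quotient.mk_surjective n
    have hm : m ∈ p.asIdeal.primeCompl := by
      intro hm
      apply hx
      rw [Ideal.Quotient.eq_zero_iff_mem.2 hm, LocalizedModule.zero_mk]
    refine ⟨Localization.mk (n * s) (t * ⟨m, hm⟩), ?_⟩
    rw [LinearMap.toSpanSingleton_apply, LocalizedModule.mk_smul_mk, LocalizedModule.mk_eq]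
    refine ⟨1, ?_⟩
    simp only [Submonoid.smul_def, ← Ideal.Quotient.mk_eq_mk, ← Submodule.Quotient.mk_smul]
    congr 1
    simp
    ring

theorem alg_smul (S : Submonoid R) {M : Type u} [AddCommGroup M] [Module R M] (r : R)
    (x : LocalizedModule S M) : algebraMap R (Localization S) r • x = r • x :=
  algebraMap_smul _ _ _

theorem loc_subsingleton (S : Submonoid R) {M : Type u} [AddCommGroup M] [Module R M]
    [Subsingleton M] : Subsingleton (LocalizedModule S M) := by
  refine subsingleton_of_forall_eq 0 fun x => ?_
  induction x using LocalizedModule.induction_on with | _ m s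
  rw [Subsingleton.elim m 0, LocalizedModule.zero_mk]

theorem tors_p (p : PrimeSpectrum R) (hp : p.asIdeal ∈ I.minimalPrimes) :
    Tors I (R ⧸ p.asIdeal) := by
  intro x
  obtain ⟨x, rfl⟩ := Ideal.Quotient.mk_surjective x
  refine ⟨1, fun a ha => ?_⟩
  rw [pow_one] at ha
  rw [← Ideal.Quotient.mk_eq_mk, ← Submodule.Quotient.mk_smul, Submodule.Quotient.mk_eq_zero]
  exact Ideal.mul_mem_right _ _ (hp.1.2 ha)

/-- the localized local cohomology theory. -/
noncomputable def theLCT [IsNoetherianRing R] (p : PrimeSpectrum R)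
    (hp : p.asIdeal ∈ I.minimalPrimes) :
    LCT R p (Localization p.asIdeal.primeCompl) where
  T i M _ _ := ModuleCat.of _ (LocalizedModule p.asIdeal.primeCompl (Hh I i M))
  map i M N _ _ _ _ f := LocalizedModule.map _ (mapH I i f)
  map_smul_id i M _ _ r x := by
    change LocalizedModule p.asIdeal.primeCompl (Hh I i M) at x
    change LocalizedModule.map _ (mapH I i (r • LinearMap.id)) x =
      algebraMap R (Localization _) r • x
    rw [alg_smul]
    induction x using LocalizedModule.induction_on with | _ m s
    rw [LocalizedModule.map_mk, mapH_smul_id, LocalizedModule.smul'_mk]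
  map_comp i M N Q _ _ _ _ _ _ f g x := by
    change LocalizedModule p.asIdeal.primeCompl (Hh I i M) at x
    induction x using LocalizedModule.induction_on with | _ m s
    simp only [LocalizedModule.map_mk, mapH_comp]
  exact₂ i M N Q _ _ _ _ _ _ f g hf hg h := loc_exact _ _ _ (mapH_exact I i f g hf hg h)
  exactδ i M N Q _ _ _ _ _ _ f g hf hg h :=
    ⟨LocalizedModule.map _ (dH I i f g hf hg h), loc_exact _ _ _ (dH_exact₁ I i f g hf hg h),
      loc_exact _ _ _ (dH_exact₂ I i f g hf hg h)⟩
  inj₀ {M N} _ _ _ _ f hf := LocalizedModule.map_injective _ _ (mapH_inj I f hf)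
  torsion i M _ _ x := by
    change LocalizedModule p.asIdeal.primeCompl (Hh I i M) at x
    change ∃ c : ℕ, ∀ a ∈ p.asIdeal ^ c, algebraMap R (Localization p.asIdeal.primeCompl) a • x = 0
    set K := Ideal.torsionOf (Localization p.asIdeal.primeCompl) _ x with hK
    have h1 : ∃ t, (I ^ t).map (algebraMap R (Localization p.asIdeal.primeCompl)) ≤ K := by
      clear_value K
      induction x using LocalizedModule.induction_on with | _ m s
      obtain ⟨t, ht⟩ := pow_smul_H I i m
      refine ⟨t, Ideal.map_le_iff_le_comap.2 fun a ha => ?_⟩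
      rw [Ideal.mem_comap, hK, Ideal.mem_torsionOf_iff, alg_smul, LocalizedModule.smul'_mk, ht a ha,
        LocalizedModule.zero_mk]
    obtain ⟨t, ht⟩ := h1
    have h2 : p.asIdeal.map (algebraMap R (Localization p.asIdeal.primeCompl)) ≤ K.radical := by
      have h3 := IsLocalization.AtPrime.radical_map_of_mem_minimalPrimes
        (Localization p.asIdeal.primeCompl) p.asIdeal I hp
      rw [← h3]
      intro a ha
      obtain ⟨k, hk⟩ := ha
      refine ⟨k * t, ht ?_⟩
      rw [Ideal.map_pow, pow_mul]
      exact Ideal.pow_mem_pow hk t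
    obtain ⟨c, hc⟩ := Ideal.exists_pow_le_of_le_radical_of_fg h2 (IsNoetherian.noetherian _)
    refine ⟨c, fun a ha => ?_⟩
    rw [← Ideal.mem_torsionOf_iff]
    apply hc
    rw [← Ideal.map_pow]
    exact Ideal.mem_map_of_mem _ ha
  unit s hs := IsLocalization.map_units (M := p.asIdeal.primeCompl) _ ⟨s, hs⟩
  vanish_p i := by
    have : Subsingleton (Hh I (i + 1) (R ⧸ p.asIdeal)) := H_tors I i _ (tors_p I p hp)
    exact loc_subsingleton _
  artinian_p := by
    have := loc_simple p
    have hA : IsArtinian (Localization p.asIdeal.primeCompl)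
      (LocalizedModule p.asIdeal.primeCompl (R ⧸ p.asIdeal)) := inferInstance
    exact isArtinian_of_injective (LocalizedModule.map p.asIdeal.primeCompl (evH I (R ⧸ p.asIdeal)))
      (LocalizedModule.map_injective _ _ (evH_injective I))
  nontrivial_p := by
    have := loc_simple p
    have hA : Nontrivial
      (LocalizedModule p.asIdeal.primeCompl (R ⧸ p.asIdeal)) := IsSimpleModule.nontrivial
        (Localization p.asIdeal.primeCompl) _
    exact (LocalizedModule.map_surjective p.asIdeal.primeCompl _
      (evH_surjective I (tors_p I p hp))).nontrivial

end
end LCC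

namespace LCC
open CategoryTheory CategoryTheory.Abelian
section
variable {R : Type u} [CommRing R]

theorem op_cyc (L : ChainComplex (ModuleCat.{u} R)ᵒᵖ ℕ) (n : ℕ) (f : (L.X n).unop)
    (hf : (L.d (n + 1) n).unop.hom f = 0) :
    ∃ z : (L.opcycles n).unop, (L.pOpcycles n).unop.hom z = f := by
  have h := ShortComplex.exact_of_g_is_cokernel
    (ShortComplex.mk (L.d (n + 1) n) (L.pOpcycles n) (by simp))
    (L.opcyclesIsCokernel (n + 1) n (by simp))
  have h2 := (ShortComplex.moduleCat_exact_iff _).1 h.unop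
  exact h2 f hf

theorem op_bdry (L : ChainComplex (ModuleCat.{u} R)ᵒᵖ ℕ) (n j : ℕ)
    (hj : (ComplexShape.down ℕ).next n = j) (z : (L.opcycles n).unop)
    (hz : (L.homologyι n).unop.hom z = 0) :
    ∃ g : (L.X j).unop, (L.fromOpcycles n j).unop.hom g = z := by
  have h := ShortComplex.exact_of_f_is_kernel
    (ShortComplex.mk (L.homologyι n) (L.fromOpcycles n j) (by simp))
    (L.homologyIsKernel n j hj)
  have h2 := (ShortComplex.moduleCat_exact_iff _).1 h.unop
  exact h2 z hz

/-- The contravariant Hom functor into `Y`. -/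
noncomputable abbrev Fy (Y : ModuleCat.{u} R) : ModuleCat.{u} R ⥤ (ModuleCat.{u} R)ᵒᵖ :=
  ((linearYoneda R (ModuleCat.{u} R)).obj Y).rightOp

/-- The complex of homs. -/
noncomputable abbrev Ly {X : ModuleCat.{u} R} (P : ProjectiveResolution X) (Y : ModuleCat.{u} R) :
    ChainComplex (ModuleCat.{u} R)ᵒᵖ ℕ :=
  ((Fy Y).mapHomologicalComplex _).obj P.complex

/-- The cochain `f` represents the class `e`. -/
def Rel {X : ModuleCat.{u} R} (P : ProjectiveResolution X) (Y : ModuleCat.{u} R) (n : ℕ)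
    (f : P.complex.X n ⟶ Y) (e : (((Fy Y).leftDerived n).obj X).unop) : Prop :=
  ∃ z : ((Ly P Y).opcycles n).unop, ((Ly P Y).pOpcycles n).unop.hom z = f ∧
    (P.isoLeftDerivedObj (Fy Y) n).hom.unop.hom (((Ly P Y).homologyι n).unop.hom z) = e

variable {X : ModuleCat.{u} R} (P : ProjectiveResolution X) (Y : ModuleCat.{u} R) (n : ℕ)

theorem Rel.exists (f : P.complex.X n ⟶ Y) (hf : P.complex.d (n + 1) n ≫ f = 0) :
    ∃ e, Rel P Y n f e := by
  obtain ⟨z, hz⟩ := op_cyc (Ly P Y) n f hf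
  exact ⟨_, z, hz, rfl⟩

variable {P Y n}

theorem Rel.smul {f : P.complex.X n ⟶ Y} {e} (h : Rel P Y n f e) (r : R) :
    Rel P Y n (r • f) (r • e) := by
  obtain ⟨z, hz, rfl⟩ := h
  refine ⟨r • z, ?_, ?_⟩
  · rw [map_smul, hz]; rfl
  · rw [map_smul]; exact LinearMap.map_smul _ _ _

theorem Rel.zero {f : P.complex.X n ⟶ Y} (h : Rel P Y n f 0) (j : ℕ)
    (hj : (ComplexShape.down ℕ).next n = j) :
    ∃ g : P.complex.X j ⟶ Y, P.complex.d n j ≫ g = f := by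
  obtain ⟨z, hz, h⟩ := h
  have h0 : ((Ly P Y).homologyι n).unop.hom z = 0 := by
    have h1 : Function.Injective (P.isoLeftDerivedObj (Fy Y) n).hom.unop.hom :=
      (ModuleCat.mono_iff_injective _).1 inferInstance
    exact h1 (h.trans (map_zero _).symm)
  obtain ⟨g, hg⟩ := op_bdry (Ly P Y) n j hj z h0
  refine ⟨g, ?_⟩
  rw [← hz, ← hg]
  have := (Ly P Y).p_fromOpcycles n j
  have h2 := congrArg (fun q => q.unop.hom g) this
  exact h2.symm

theorem Rel.map {X' : ModuleCat.{u} R} {P' : ProjectiveResolution X'} {q : X' ⟶ X}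
    (φ : ProjectiveResolution.Hom P' P q) {f : P.complex.X n ⟶ Y} {e} (h : Rel P Y n f e) :
    Rel P' Y n (φ.hom.f n ≫ f) ((((Fy Y).leftDerived n).map q).unop.hom e) := by
  obtain ⟨z, hz, rfl⟩ := h
  let ψ := ((Fy Y).mapHomologicalComplex (ComplexShape.down ℕ)).map φ.hom
  refine ⟨(HomologicalComplex.opcyclesMap ψ n).unop.hom z, ?_, ?_⟩
  · have := HomologicalComplex.p_opcyclesMap ψ n
    have h2 := congrArg (fun q => q.unop.hom z) this
    refine h2.trans ?_
    rw [← hz]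
    rfl
  · have h1 := P'.isoLeftDerivedObj_hom_naturality q P φ.hom (by
      simpa using φ.hom_f_zero_comp_π_f_zero) (Fy Y) n
    have h2 := HomologicalComplex.homologyι_naturality ψ n
    have h3 := congrArg (fun q => (q ≫ (Ly P Y).homologyι n).unop.hom z) h1
    refine Eq.trans ?_ h3.symm
    have h4 := congrArg (fun q => ((P'.isoLeftDerivedObj (Fy Y) n).hom ≫ q).unop.hom z) h2
    exact h4.symm

theorem extMk_zero_of {f : P.complex.X n ⟶ Y} (hf : P.complex.d (n + 1) n ≫ f = 0)
    (h : Rel P Y n f 0) : P.extMk f (n + 1) rfl hf = 0 := by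
  cases n with
  | zero =>
    obtain ⟨g, hg⟩ := h.zero 0 (by simp)
    have : f = 0 := by
      rw [← hg, P.complex.shape _ _ (by simp)]; simp
    subst this
    simp
  | succ k =>
    rw [P.extMk_eq_zero_iff f (k + 2) rfl hf k rfl]
    exact h.zero k (by simp)

end
end LCC

namespace LCC
open CategoryTheory CategoryTheory.Abelian
section
variable {R : Type u} [CommRing R] (I : Ideal R)

theorem lc_zero (n : ℕ) (M : ModuleCat.{u} R) (r : R)
    (hr : r ∈ Module.annihilator R ((localCohomology I n).obj M)) (t : ℕ)
    (e : (((Fy M).leftDerived n).obj (Qt I t)).unop) :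
    ∃ (s : ℕ) (h : t ≤ s), (((Fy M).leftDerived n).map (qmap I h)).unop.hom (r • e) = 0 := by
  let D := localCohomology.diagram (localCohomology.idealPowersDiagram I) n
  have hc : Limits.HasColimit D := localCohomology.hasColimitDiagram _ n
  let c := Limits.colimit.cocone D
  have hcl : Limits.IsColimit (((evaluation _ _).obj M).mapCocone c) :=
    Limits.isColimitOfPreserves _ (Limits.colimit.isColimit D)
  have h0 : (((evaluation _ _).obj M).mapCocone c).ι.app (Opposite.op (Opposite.op t))
        (r • e : (((Fy M).leftDerived n).obj (Qt I t)).unop)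
      = (((evaluation _ _).obj M).mapCocone c).ι.app (Opposite.op (Opposite.op t))
        (0 : (((Fy M).leftDerived n).obj (Qt I t)).unop) := by
    let w := ((((evaluation _ _).obj M).mapCocone c).ι.app (Opposite.op (Opposite.op t))).hom
    change w (r • e) = w 0
    refine (w.map_smul r e).trans ?_
    refine Eq.trans ?_ (w.map_zero).symm
    exact Module.mem_annihilator.1 hr _
  have : Limits.PreservesFilteredColimitsOfSize.{0,0} (forget (ModuleCat.{u} R)) :=
    Limits.preservesFilteredColimitsOfSize_shrink _
  obtain ⟨k, f, g, hk⟩ :=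
    Limits.Concrete.isColimit_exists_of_rep_eq (D ⋙ (evaluation _ _).obj M) hcl _ _ h0
  refine ⟨k.unop.unop, f.unop.unop.down.down, ?_⟩
  refine Eq.trans (Eq.trans ?_ hk) ?_
  · rfl
  · exact map_zero ((D ⋙ (evaluation _ _).obj M).map g).hom

theorem new_zero (n : ℕ) (M : ModuleCat.{u} R) (r : R)
    (hr : r ∈ Module.annihilator R ((localCohomology I n).obj M)) (x : Hh I n M) : r • x = 0 := by
  obtain ⟨t, α, rfl⟩ := exists_ofH I n M x
  let P : ∀ t, ProjectiveResolution (Qt I t) := fun t => projectiveResolution (Qt I t)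
  obtain ⟨f, hf, rfl⟩ := (P t).extMk_surjective α (n + 1) rfl
  obtain ⟨e, he⟩ := Rel.exists (P t) M n f hf
  obtain ⟨s, h, hs⟩ := lc_zero I n M r hr t e
  let φ : ProjectiveResolution.Hom (P s) (P t) (qmap I h) :=
    { hom := ProjectiveResolution.lift (qmap I h) (P s) (P t)
      hom_f_zero_comp_π_f_zero := by
        have := ProjectiveResolution.lift_commutes (qmap I h) (P s) (P t)
        have h2 := congrArg (fun q => q.f 0) this
        exact h2 }
  have h1 := (he.smul r).map φ
  rw [hs] at h1
  have h2 := extMk_zero_of (by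
    simp [← φ.hom.comm_assoc, hf]) h1
  rw [← map_smul, ← ofH_tr I n M t s h, tr_apply]
  have h3 : r • (P t).extMk f (n + 1) rfl hf = (P t).extMk (r • f) (n + 1) rfl (by simp [hf]) := by
    rw [Ext.smul_eq_comp_mk₀, ProjectiveResolution.extMk_comp_mk₀]
    congr 1
  erw [h3, ProjectiveResolution.mk₀_comp_extMk (r • f) (n + 1) rfl _ φ, h2, map_zero]

end
end LCC

theorem stmt_aux {R : Type u} [CommRing R] [IsDomain R] [IsNoetherianRing R]
    (𝔞 : Ideal R) (n : ℕ) (p : PrimeSpectrum R)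
    (hp : Minimal (fun q : PrimeSpectrum R => 𝔞 ≤ q.asIdeal) p) (hh : Order.height p = (n : ℕ∞)) :
    Module.annihilator R ((localCohomology 𝔞 n).obj (ModuleCat.of R R)) = ⊥ := by
  rw [eq_bot_iff]
  intro r hr
  have hp' : p.asIdeal ∈ 𝔞.minimalPrimes := by
    refine ⟨⟨p.2, hp.1⟩, fun q hq hqp => ?_⟩
    exact hp.2 (y := ⟨q, hq.1⟩) hq.2 hqp
  refine (LCC.theLCT 𝔞 p hp').final n hh r fun x => ?_
  suffices key : ∀ x : LocalizedModule p.asIdeal.primeCompl (LCC.Hh 𝔞 n R),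
    algebraMap R (Localization p.asIdeal.primeCompl) r • x = 0 from key x
  clear x
  intro x
  rw [LCC.alg_smul]
  induction x using LocalizedModule.induction_on with | _ m s
  rw [LocalizedModule.smul'_mk]
  have := LCC.new_zero 𝔞 n (ModuleCat.of R R) r hr m
  erw [this]
  exact LocalizedModule.zero_mk s

theorem exists_height {R : Type u} [CommRing R] (I : Ideal R) (n : ℕ)
    (hn : (⨅ p ∈ {p : PrimeSpectrum R | Minimal (fun q : PrimeSpectrum R => I ≤ q.asIdeal) p},
    Order.height p) = (n : ℕ∞)) :
    ∃ p : PrimeSpectrum R, Minimal (fun q : PrimeSpectrum R => I ≤ q.asIdeal) p ∧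
      Order.height p = (n : ℕ∞) := by
  rw [← sInf_image] at hn
  have hne : (Order.height '' {p : PrimeSpectrum R |
      Minimal (fun q : PrimeSpectrum R => I ≤ q.asIdeal) p}).Nonempty := by
    by_contra h
    rw [Set.not_nonempty_iff_eq_empty] at h
    rw [h, sInf_empty] at hn
    exact ENat.top_ne_natCast n hn
  obtain ⟨p, hp, h⟩ := csInf_mem hne
  exact ⟨p, hp, h.trans hn⟩

/-- If `R` is a Noetherian domain and `𝔞` an ideal of height `n`, then
`Ann_R(H^n_𝔞(R)) = 0`. -/
theorem stmt_18 {R : Type u} [CommRing R] [IsDomain R] [IsNoetherianRing R]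
    (𝔞 : Ideal R) (n : ℕ) (hn : idealHeight 𝔞 = (n : ℕ∞)) :
    Module.annihilator R ((localCohomology 𝔞 n).obj (ModuleCat.of R R)) = ⊥ := by
  obtain ⟨p, hp, hh⟩ := exists_height 𝔞 n hn
  exact stmt_aux 𝔞 n p hp hh
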